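/- arXiv:1912.03875 — 4 statements merged into one kernel-verified Lean document; each statement's English description precedes it below -/
import Mathlib

section
/- Let k ≥ 1 and p ≥ 1 be integers and let S ⊆ ℝ^p be a weakly k-neighborly set that has at least k elements and contains a subset of p+2 points in general linear position. Then p ≥ 2k. -/
/-- A set `S ⊆ ℝ^N` is weakly `k`-neighborly if for every subset `T ⊆ S` with exactly
`k` elements there is a closed half-space containing `S` whose boundary hyperplane
contains `T`. -/
def WeaklyNeighborly {N : ℕ} (k : ℕ) (S : Set (Fin N → ℝ)) : Prop :=
  ∀ T ⊆ S, T.Finite → T.ncard = k →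
    ∃ (a : Fin N → ℝ) (c : ℝ), a ≠ 0 ∧
      (∀ x ∈ T, ∑ i, a i * x i = c) ∧
      (∀ x ∈ S, ∑ i, a i * x i ≤ c)

open Finset in
/-- If `S` is weakly `k`-neighborly and an affine dependence on a finite subset `P` has at
most `k` positive coefficients, then some supporting hyperplane of `S` contains all points
of `P` with non-zero coefficient. -/
theorem WeaklyNeighborly.exists_hyperplane_of_dependence {p k : ℕ} {S : Set (Fin p → ℝ)}
    (hwn : WeaklyNeighborly k S) (hbig : ∃ T : Finset (Fin p → ℝ), ↑T ⊆ S ∧ T.card = k)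
    {P : Finset (Fin p → ℝ)} (hPS : ↑P ⊆ S) {w : (Fin p → ℝ) → ℝ}
    (hw : ∑ x ∈ P, w x • x = 0) (hw0 : ∑ x ∈ P, w x = 0)
    (hcard : (P.filter fun x => 0 < w x).card ≤ k) :
    ∃ (a : Fin p → ℝ) (c : ℝ), a ≠ 0 ∧ ∀ x ∈ P, w x ≠ 0 → ∑ i, a i * x i = c := by
  classical
  obtain ⟨T, hTS, hT⟩ := hbig
  obtain ⟨U, hAU, hUT, hU⟩ := Finset.exists_subsuperset_card_eq
    (subset_union_left (s₁ := P.filter fun x => 0 < w x) (s₂ := T)) hcard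
    (hT ▸ card_le_card subset_union_right)
  have hUS : (U : Set (Fin p → ℝ)) ⊆ S := fun x hx => by
    rcases mem_union.1 (hUT hx) with h | h
    · exact hPS (mem_filter.1 h).1
    · exact hTS h
  obtain ⟨a, c, ha, haU, haS⟩ := hwn U hUS U.finite_toSet (by rw [Set.ncard_coe_finset, hU])
  refine ⟨a, c, ha, ?_⟩
  have hsum : ∑ x ∈ P, w x * (∑ i, a i * x i - c) = 0 := by
    have h : a ⬝ᵥ ∑ x ∈ P, w x • x = 0 := by rw [hw, dotProduct_zero]
    simp only [dotProduct_sum, dotProduct_smul, smul_eq_mul] at h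
    simp only [dotProduct] at h
    simp only [mul_sub, sum_sub_distrib, ← sum_mul, hw0, h, zero_mul, sub_zero]
  have hnonneg : ∀ x ∈ P, 0 ≤ w x * (∑ i, a i * x i - c) := fun x hx => by
    rcases lt_or_ge 0 (w x) with h | h
    · rw [haU x (hAU (mem_filter.2 ⟨hx, h⟩)), sub_self, mul_zero]
    · exact mul_nonneg_of_nonpos_of_nonpos h (sub_nonpos.2 (haS x (hPS hx)))
  intro x hx hwx
  have := (sum_eq_zero_iff_of_nonneg hnonneg).1 hsum x hx
  exact sub_eq_zero.1 ((mul_eq_zero.1 this).resolve_left hwx)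

/-- A linear equation satisfied by `p + 1` affinely independent points of `ℝ^p` is trivial. -/
theorem eq_zero_of_affineIndependent_of_forall_sum_mul_eq {p : ℕ} {Q : Finset (Fin p → ℝ)}
    (hQ : AffineIndependent ℝ (fun q : (Q : Set (Fin p → ℝ)) => (q : Fin p → ℝ)))
    (hcard : Q.card = p + 1) {a : Fin p → ℝ} {c : ℝ}
    (h : ∀ x ∈ Q, ∑ i, a i * x i = c) : a = 0 := by
  have htop : affineSpan ℝ (Q : Set (Fin p → ℝ)) = ⊤ := by
    have := (hQ.affineSpan_eq_top_iff_card_eq_finrank_add_one).2 (by simp [hcard])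
    simpa using this
  have hall : ∀ x : Fin p → ℝ, a ⬝ᵥ x = c := fun x => by
    have hx : x ∈ affineSpan ℝ (Q : Set (Fin p → ℝ)) := htop ▸ AffineSubspace.mem_top ℝ _ x
    refine affineSpan_induction (p := fun x => a ⬝ᵥ x = c) hx h fun t u v w hu hv hw => ?_
    simp only [vsub_eq_sub, vadd_eq_add, dotProduct_add, dotProduct_smul, dotProduct_sub, hu, hv,
      hw, sub_self, smul_zero, zero_add]
  have hc : c = 0 := by rw [← hall 0, dotProduct_zero]
  ext i
  simpa [hc] using hall (Pi.single i 1)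

/-- If `S ⊆ ℝ^p` is weakly `k`-neighborly (`k ≥ 1`), has at least `k` elements, and
contains `p+2` points in general linear position (every subset of at most `p+1` of them
is affinely independent), then `p ≥ 2k`. -/
theorem weakly_neighborly_lower_bound (p k : ℕ) (hk : 1 ≤ k) (hp : 1 ≤ p)
    (S : Set (Fin p → ℝ)) (hwn : WeaklyNeighborly k S)
    (hbig : ∃ T : Finset (Fin p → ℝ), ↑T ⊆ S ∧ T.card = k)
    (hgp : ∃ P : Finset (Fin p → ℝ), ↑P ⊆ S ∧ P.card = p + 2 ∧
      ∀ Q ⊆ P, Q.card ≤ p + 1 →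
        AffineIndependent ℝ (fun q : (Q : Set (Fin p → ℝ)) => (q : Fin p → ℝ))) :
    2 * k ≤ p := by
  classical
  obtain ⟨P, hPS, hPc, hP⟩ := hgp
  obtain ⟨w, hw, hw0, y, hyP, hy⟩ :=
    Module.exists_nontrivial_relation_sum_zero_of_finrank_succ_lt_card (R := ℝ) (t := P)
      (by simp [hPc])
  have hindep : ∀ z ∈ P, (P.erase z).card = p + 1 ∧
      AffineIndependent ℝ (fun q : ((P.erase z : Finset _) : Set (Fin p → ℝ)) =>
        (q : Fin p → ℝ)) := fun z hz => by
    have hc : (P.erase z).card = p + 1 := by rw [Finset.card_erase_of_mem hz, hPc]; rfl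
    exact ⟨hc, hP _ (Finset.erase_subset _ _) hc.le⟩
  have hne : ∀ z ∈ P, w z ≠ 0 := fun z hz hwz => by
    have hyz : y ∈ P.erase z := Finset.mem_erase.2 ⟨fun h => hy (h ▸ hwz), hyP⟩
    refine hy ((affineIndependent_iff.1 (hindep z hz).2) Finset.univ (fun q => w q) ?_ ?_
      ⟨y, hyz⟩ (Finset.mem_univ _))
    · refine (Finset.sum_coe_sort (P.erase z) w).trans ?_
      rw [Finset.sum_erase P hwz, hw0]
    · refine (Finset.sum_coe_sort (P.erase z) fun x => w x • x).trans ?_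
      rw [Finset.sum_erase P (by rw [hwz, zero_smul]), hw]
  by_contra! hlt
  have hcards : (P.filter fun x => 0 < w x).card + (P.filter fun x => 0 < -w x).card ≤ p + 2 := by
    rw [← hPc, ← Finset.card_union_of_disjoint]
    · exact Finset.card_le_card
        (Finset.union_subset (Finset.filter_subset _ _) (Finset.filter_subset _ _))
    · exact Finset.disjoint_filter.2 fun x _ h h' => by linarith
  obtain ⟨a, c, ha, hac⟩ : ∃ (a : Fin p → ℝ) (c : ℝ), a ≠ 0 ∧ ∀ x ∈ P, ∑ i, a i * x i = c := by
    rcases le_or_gt (P.filter fun x => 0 < w x).card k with h | h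
    · obtain ⟨a, c, ha, hac⟩ := hwn.exists_hyperplane_of_dependence hbig hPS hw hw0 h
      exact ⟨a, c, ha, fun x hx => hac x hx (hne x hx)⟩
    · obtain ⟨a, c, ha, hac⟩ := hwn.exists_hyperplane_of_dependence hbig hPS
        (w := fun x => -w x) (by simp [hw]) (by simp [hw0]) (by omega)
      exact ⟨a, c, ha, fun x hx => hac x hx (neg_ne_zero.2 (hne x hx))⟩
  exact ha (eq_zero_of_affineIndependent_of_forall_sum_mul_eq (hindep y hyP).2 (hindep y hyP).1
    fun x hx => hac x (Finset.mem_of_mem_erase hx))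
end

section
/- Let p ≥ 1 and k ≥ 1 be integers and let S ⊆ ℝ^p be an arbitrary (possibly infinite) set. Then S is weakly k-neighborly if and only if every finite subset of S is weakly k-neighborly. -/
/-- The normal vector of a supporting hyperplane of `S` through all points of `T` can be taken on
the unit sphere, and any point `t ∈ T` determines the offset. -/
theorem WeaklyNeighborly.exists_mem_sphere {N k : ℕ} {S T : Set (Fin N → ℝ)}
    (hS : WeaklyNeighborly k S) (hTS : T ⊆ S) (hT : T.Finite) (hTk : T.ncard = k)
    {t : Fin N → ℝ} (ht : t ∈ T) :
    ∃ a ∈ Metric.sphere (0 : Fin N → ℝ) 1,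
      (∀ x ∈ T, a ⬝ᵥ x = a ⬝ᵥ t) ∧ ∀ x ∈ S, a ⬝ᵥ x ≤ a ⬝ᵥ t := by
  obtain ⟨a, c, ha, hc, hle⟩ := hS T hTS hT hTk
  change ∀ x ∈ T, a ⬝ᵥ x = c at hc
  change ∀ x ∈ S, a ⬝ᵥ x ≤ c at hle
  refine ⟨‖a‖⁻¹ • a, ?_, fun x hx => ?_, fun x hx => ?_⟩
  · simp [norm_smul, ha]
  · rw [smul_dotProduct, smul_dotProduct, hc x hx, hc t ht]
  · rw [smul_dotProduct, smul_dotProduct, hc t ht]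
    exact smul_le_smul_of_nonneg_left (hle x hx) (by positivity)

/-- Compactness of weak neighborliness: an arbitrary (possibly infinite) set
`S ⊆ ℝ^p` is weakly `k`-neighborly if and only if every finite subset of `S` is weakly
`k`-neighborly. -/
theorem weakly_neighborly_compactness (p k : ℕ) (hp : 1 ≤ p) (hk : 1 ≤ k)
    (S : Set (Fin p → ℝ)) :
    WeaklyNeighborly k S ↔
      ∀ F : Finset (Fin p → ℝ), ↑F ⊆ S → WeaklyNeighborly k (↑F : Set (Fin p → ℝ)) := by
  constructor
  · intro h F hF T hTF hT hTk
    obtain ⟨a, c, ha, hc, hle⟩ := h T (hTF.trans hF) hT hTk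
    exact ⟨a, c, ha, hc, fun x hx => hle x (hF hx)⟩
  · intro h T hTS hT hTk
    obtain ⟨t, ht⟩ : T.Nonempty := Set.nonempty_of_ncard_ne_zero (by lia)
    let H : S → Set (Fin p → ℝ) := fun x =>
      {a | (∀ y ∈ T, a ⬝ᵥ y = a ⬝ᵥ t) ∧ a ⬝ᵥ x.1 ≤ a ⬝ᵥ t}
    have hcont (y : Fin p → ℝ) : Continuous fun a : Fin p → ℝ => a ⬝ᵥ y := by
      fun_prop
    have hclosed (x : S) : IsClosed (H x) := by
      simp only [H, Set.ofPred_and, Set.ofPred_forall]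
      exact (isClosed_biInter fun y _ => isClosed_eq (hcont y) (hcont t)).inter
        (isClosed_le (hcont x.1) (hcont t))
    have hfin (u : Finset S) :
        (Metric.sphere (0 : Fin p → ℝ) 1 ∩ ⋂ x ∈ u, H x).Nonempty := by
      classical
      let F : Finset (Fin p → ℝ) := hT.toFinset ∪ u.image Subtype.val
      have hFS : (F : Set (Fin p → ℝ)) ⊆ S := by
        simpa [F] using hTS
      have hTF : T ⊆ (F : Set (Fin p → ℝ)) := by
        simp [F]
      obtain ⟨a, ha, haT, haF⟩ := (h F hFS).exists_mem_sphere hTF hT hTk ht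
      refine ⟨a, ha, Set.mem_iInter₂.2 fun x hx => ⟨haT, haF x.1 ?_⟩⟩
      simp [F, hx]
    obtain ⟨a, ha, haH⟩ := (isCompact_sphere _ _).inter_iInter_nonempty H hclosed hfin
    rw [Set.mem_iInter] at haH
    exact ⟨a, a ⬝ᵥ t, ne_zero_of_mem_unit_sphere ⟨a, ha⟩, (haH ⟨t, hTS ht⟩).1,
      fun x hx => (haH ⟨x, hx⟩).2⟩
end

section
/- Let P be a set of p+2 points in ℝ^p (p ≥ 1) in general linear position. Then there is a partition of P into two nonempty disjoint sets Q and R with Q ∪ R = P such that the relative interior of conv(Q) and the relative interior of conv(R) have a common point. -/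
/-- A convex combination with positive weights of affinely independent points lies in the
intrinsic interior of their convex hull. -/
theorem AffineIndependent.centerMass_mem_intrinsicInterior_convexHull {E : Type*}
    [NormedAddCommGroup E] [NormedSpace ℝ E] [FiniteDimensional ℝ E] {s : Finset E}
    (hs : AffineIndependent ℝ (fun x : (s : Set E) => (x : E))) (hne : s.Nonempty)
    {w : E → ℝ} (hw : ∀ x ∈ s, 0 < w x) :
    s.centerMass w id ∈ intrinsicInterior ℝ (convexHull ℝ (s : Set E)) := by
  obtain ⟨t, hst, ht, htop⟩ := exists_subset_affineIndependent_affineSpan_eq_top hs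
  let b : AffineBasis t ℝ E := ⟨((↑) : t → E), ht, by simpa using htop⟩
  let c : s → E →ᵃ[ℝ] ℝ := fun i => b.coord ⟨i, hst i.2⟩
  have hc : ∀ (i : s) (v : s → ℝ), ∑ j, v j = 1 →
      c i (Finset.univ.affineCombination ℝ ((↑) : s → E) v) = v i := by
    classical
    intro i v hv
    have key : ∀ j : s, c i j = if i = j then 1 else 0 := fun j => by
      refine (b.coord_apply ⟨i, hst i.2⟩ ⟨j, hst j.2⟩).trans ?_
      simp only [Subtype.ext_iff]
    rw [Finset.map_affineCombination _ _ _ hv,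
      Finset.affineCombination_eq_linear_combination _ _ _ hv]
    simp [key]
  have hsum : 0 < ∑ x ∈ s, w x := Finset.sum_pos hw hne
  have hv : ∑ j : s, (∑ x ∈ s, w x)⁻¹ * w j = 1 := by
    rw [← Finset.mul_sum, Finset.sum_coe_sort s w, inv_mul_cancel₀ hsum.ne']
  have hx : s.centerMass w id = Finset.univ.affineCombination ℝ ((↑) : s → E)
      (fun j => (∑ x ∈ s, w x)⁻¹ * w j) := by
    rw [Finset.affineCombination_eq_linear_combination _ _ _ hv, Finset.centerMass,
      Finset.smul_sum, ← Finset.sum_coe_sort s]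
    simp [mul_smul]
  have hmem : s.centerMass w id ∈ convexHull ℝ (s : Set E) :=
    s.centerMass_id_mem_convexHull (fun x hx => (hw x hx).le) hsum
  rw [mem_intrinsicInterior]
  refine ⟨⟨_, subset_affineSpan ℝ _ hmem⟩, ?_, rfl⟩
  rw [mem_interior]
  refine ⟨{y | ∀ i, 0 < c i y}, ?_, ?_, ?_⟩
  · rintro ⟨y, hy⟩ hpos
    rw [affineSpan_convexHull] at hy
    obtain ⟨v, hv1, rfl⟩ := eq_affineCombination_of_mem_affineSpan_of_fintype
      (p := ((↑) : s → E)) (by simpa using hy)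
    have h0 : ∀ i ∈ Finset.univ, 0 ≤ v i := fun i _ => by
      have := hpos i
      rw [hc i v hv1] at this
      exact this.le
    have hmem := affineCombination_mem_convexHull (v := ((↑) : s → E)) h0 hv1
    rwa [show Set.range ((↑) : s → E) = s from Subtype.range_coe] at hmem
  · simp only [Set.ofPred_forall]
    exact isOpen_iInter_of_finite fun i => isOpen_lt continuous_const
      ((c i).continuous_of_finiteDimensional.comp continuous_subtype_val)
  · intro i
    simp only [hx]
    rw [hc i _ hv]
    exact mul_pos (inv_pos.2 hsum) (hw i i.2)


/-- Radon-type theorem: if `P` is a set of `p+2` points in `ℝ^p` in general linear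
position (every subset of at most `p+1` of them is affinely independent), then `P` can
be partitioned into two nonempty sets `Q` and `R` such that the relative (intrinsic)
interiors of `conv Q` and `conv R` intersect. -/
theorem radon_relint (p : ℕ) (hp : 1 ≤ p) (P : Finset (Fin p → ℝ))
    (hcard : P.card = p + 2)
    (hgen : ∀ T ⊆ P, T.card ≤ p + 1 →
      AffineIndependent ℝ (fun t : (T : Set (Fin p → ℝ)) => (t : Fin p → ℝ))) :
    ∃ Q R : Finset (Fin p → ℝ), Q.Nonempty ∧ R.Nonempty ∧ Disjoint Q R ∧
      Q ∪ R = P ∧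
      (intrinsicInterior ℝ (convexHull ℝ (Q : Set (Fin p → ℝ))) ∩
        intrinsicInterior ℝ (convexHull ℝ (R : Set (Fin p → ℝ)))).Nonempty := by
  classical
  have hdep : ¬ AffineIndependent ℝ (fun x : P => (x : Fin p → ℝ)) := fun h => by
    have := h.card_le_finrank_succ.trans
      (Nat.succ_le_succ (Submodule.finrank_le (vectorSpan ℝ _)))
    simp [hcard] at this
  obtain ⟨w, hwx, hw0, z, hzP, hz⟩ := exists_nontrivial_relation_sum_zero_of_not_affine_ind hdep
  have hne : ∀ x ∈ P, w x ≠ 0 := by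
    intro x hx hwx0
    have hind := hgen (P.erase x) (P.erase_subset x) (by simp [Finset.card_erase_of_mem hx, hcard])
    have hzx : z ≠ x := fun h => hz (h ▸ hwx0)
    refine hz ((affineIndependent_iff.1 hind) Finset.univ (fun y => w y) ?_ ?_
      ⟨z, Finset.mem_erase.2 ⟨hzx, hzP⟩⟩ (Finset.mem_univ _))
    · refine (Finset.sum_coe_sort (P.erase x) w).trans ?_
      rw [Finset.sum_erase _ hwx0, hw0]
    · refine (Finset.sum_coe_sort (P.erase x) fun y => w y • y).trans ?_
      rw [Finset.sum_erase _ (by simp [hwx0]), hwx]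
  set Q := P.filter fun x => 0 < w x with hQ
  set R := P.filter fun x => ¬ 0 < w x with hR
  have hQpos : ∀ x ∈ Q, 0 < w x := fun x hx => (Finset.mem_filter.1 hx).2
  have hRpos : ∀ x ∈ R, 0 < -w x := fun x hx => by
    obtain ⟨hxP, h⟩ := Finset.mem_filter.1 hx
    exact neg_pos.2 (lt_of_le_of_ne (not_lt.1 h) (hne x hxP))
  have hsum : ∑ x ∈ Q, w x = ∑ x ∈ R, -w x := by
    rw [Finset.sum_neg_distrib, ← add_eq_zero_iff_eq_neg, hQ, hR,
      Finset.sum_filter_add_sum_filter_not, hw0]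
  have hsmul : ∑ x ∈ Q, w x • x = ∑ x ∈ R, -w x • x := by
    simp only [neg_smul]
    rw [Finset.sum_neg_distrib, ← add_eq_zero_iff_eq_neg, hQ, hR,
      Finset.sum_filter_add_sum_filter_not, hwx]
  have hdisj : Disjoint Q R := Finset.disjoint_filter_filter_not _ _ _
  have hunion : Q ∪ R = P := Finset.filter_union_filter_not_eq _ _
  have hQR : Q.Nonempty ∨ R.Nonempty := by
    rw [← Finset.union_nonempty, hunion]
    exact ⟨z, hzP⟩
  have hQne : Q.Nonempty := by
    by_contra h
    have hRne := hQR.resolve_left h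
    rw [Finset.not_nonempty_iff_eq_empty.1 h, Finset.sum_empty] at hsum
    exact (Finset.sum_pos hRpos hRne).ne hsum
  have hRne : R.Nonempty := by
    by_contra h
    rw [Finset.not_nonempty_iff_eq_empty.1 h, Finset.sum_empty] at hsum
    exact (Finset.sum_pos hQpos hQne).ne' hsum
  have hcards : Q.card + R.card = p + 2 := by
    rw [← Finset.card_union_of_disjoint hdisj, hunion, hcard]
  have hQc := hQne.card_pos
  have hRc := hRne.card_pos
  have hcenter : Q.centerMass w id = R.centerMass (fun x => -w x) id := by
    simp only [Finset.centerMass, id, hsum, hsmul]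
  refine ⟨Q, R, hQne, hRne, hdisj, hunion, Q.centerMass w id, ?_, ?_⟩
  · exact (hgen Q (P.filter_subset _) (by omega)).centerMass_mem_intrinsicInterior_convexHull
      hQne hQpos
  · rw [hcenter]
    exact (hgen R (P.filter_subset _) (by omega)).centerMass_mem_intrinsicInterior_convexHull
      hRne hRpos
end

section
/- Let n ≥ 1 and let S be a set of 2n+1 points in the plane ℝ² in general position, meaning no three points of S are collinear and no four points of S lie on a common circle. Then for every k with 0 ≤ k ≤ 2n−2, the number of pairs (T, O), where T ⊆ S has exactly 3 elements and O is either the open disk bounded by the unique circle through the three points of T or the open exterior of that circle, such that O contains exactly k points of S \ T, is exactly 2(k+1)(2n−k−1). In particular, the number of halving circles (circles through 3 points of S with n−1 points on each side) counted with orientation is 2n², i.e., n² distinct halving circles. -/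
open Finset

/-- Twice the signed area of the triangle with vertices `p`, `q`, `s`, in the coordinates `X`, `Y`. -/
def signedArea {ι : Type*} (X Y : ι → ℝ) (p q s : ι) : ℝ :=
  (X q - X p) * (Y s - Y p) - (Y q - Y p) * (X s - X p)

theorem card_supporting_pairs_eq_one {ι : Type*} [DecidableEq ι] {L R : Finset ι} {X Y : ι → ℝ}
    (hL : L.Nonempty) (hR : R.Nonempty) (hXL : ∀ p ∈ L, X p < 0) (hXR : ∀ q ∈ R, 0 < X q)
    (hgen : ∀ p ∈ L, ∀ q ∈ R, ∀ s ∈ L ∪ R, signedArea X Y p q s = 0 → s = p ∨ s = q) :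
    #{pq ∈ L ×ˢ R | ∀ s ∈ L ∪ R, signedArea X Y pq.1 pq.2 s ≤ 0} = 1 := by
  rw [card_eq_one]
  obtain ⟨⟨p, q⟩, hpq, hmax⟩ := exists_max_image (L ×ˢ R)
    (fun pq => (Y pq.1 * X pq.2 - Y pq.2 * X pq.1) / (X pq.2 - X pq.1)) (hL.product hR)
  obtain ⟨hp, hq⟩ := mem_product.1 hpq
  dsimp only at hp hq hmax
  have hXp := hXL p hp
  have hXq := hXR q hq
  have hupper : ∀ s ∈ L ∪ R, signedArea X Y p q s ≤ 0 := by
    intro s hs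
    rcases mem_union.1 hs with hs | hs
    · have h := hmax (s, q) (mk_mem_product hs hq)
      have hXs := hXL s hs
      rw [div_le_div_iff₀ (by dsimp only; linarith) (by linarith)] at h
      refine nonpos_of_mul_nonpos_right (b := signedArea X Y p q s) (a := X q) ?_ hXq
      unfold signedArea
      dsimp only at h
      linarith
    · have h := hmax (p, s) (mk_mem_product hp hs)
      have hXs := hXR s hs
      rw [div_le_div_iff₀ (by dsimp only; linarith) (by linarith)] at h
      refine nonpos_of_mul_nonpos_right (b := signedArea X Y p q s) (a := -X p) ?_ (by linarith)
      unfold signedArea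
      dsimp only at h
      linarith
  refine ⟨(p, q), ?_⟩
  ext ⟨p', q'⟩
  simp only [mem_filter, mem_product, mem_singleton, Prod.mk.injEq]
  refine ⟨?_, ?_⟩
  · rintro ⟨⟨hp', hq'⟩, hupper'⟩
    have hXp' := hXL p' hp'
    have hXq' := hXR q' hq'
    have hp'm : p' ∈ L ∪ R := mem_union_left _ hp'
    have hq'm : q' ∈ L ∪ R := mem_union_right _ hq'
    have e1 := mul_nonneg hXq'.le (neg_nonneg.2 (hupper p' hp'm))
    have e2 := mul_nonneg (neg_nonneg.2 hXp'.le) (neg_nonneg.2 (hupper q' hq'm))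
    have e3 := mul_nonneg hXq.le (neg_nonneg.2 (hupper' p (mem_union_left _ hp)))
    have e4 := mul_nonneg (neg_nonneg.2 hXp.le) (neg_nonneg.2 (hupper' q (mem_union_right _ hq)))
    have key : X q' * -signedArea X Y p q p' + -X p' * -signedArea X Y p q q' +
        (X q * -signedArea X Y p' q' p + -X p * -signedArea X Y p' q' q) = 0 := by
      unfold signedArea; ring
    have z1 : signedArea X Y p q p' = 0 := by
      have : X q' * -signedArea X Y p q p' = 0 := by linarith
      rcases mul_eq_zero.1 this with h | h <;> linarith
    have z2 : signedArea X Y p q q' = 0 := by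
      have : -X p' * -signedArea X Y p q q' = 0 := by linarith
      rcases mul_eq_zero.1 this with h | h <;> linarith
    constructor
    · rcases hgen p hp q hq p' hp'm z1 with h | h
      · exact h
      · rw [h] at hXp'; linarith
    · rcases hgen p hp q hq q' hq'm z2 with h | h
      · rw [h] at hXq'; linarith
      · exact h
  · rintro ⟨rfl, rfl⟩
    exact ⟨⟨hp, hq⟩, hupper⟩

/-- The number of triples `T ⊆ S` for which exactly `k` points of `S \ T` satisfy `side T`. -/
def facetCount {α : Type*} [DecidableEq α] (side : Finset α → α → Prop)
    [∀ T, DecidablePred (side T)] (S : Finset α) (k : ℕ) : ℕ :=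
  #{T ∈ S.powersetCard 3 | #{s ∈ S \ T | side T s} = k}

theorem sum_facetCount_erase {α : Type*} [DecidableEq α] (side : Finset α → α → Prop)
    [∀ T, DecidablePred (side T)] (S : Finset α) (k : ℕ) :
    ∑ x ∈ S, facetCount side (S.erase x) k =
      (#S - 3 - k) * facetCount side S k + (k + 1) * facetCount side S (k + 1) := by
  have hswap : ∑ x ∈ S, facetCount side (S.erase x) k =
      ∑ T ∈ S.powersetCard 3, #{x ∈ S \ T | #{s ∈ (S \ T).erase x | side T s} = k} := by
    have h := sum_card_bipartiteAbove_eq_sum_card_bipartiteBelow (s := S) (t := S.powersetCard 3)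
      (fun x T => x ∉ T ∧ #{s ∈ (S \ T).erase x | side T s} = k)
    unfold bipartiteAbove bipartiteBelow at h
    convert h using 3 with x hx T hT
    · unfold facetCount
      congr 1
      ext T
      simp only [mem_filter, mem_powersetCard, subset_erase, erase_sdiff_comm]
      tauto
    · ext x
      simp only [mem_filter, mem_sdiff]
      tauto
  have hT : ∀ T ∈ S.powersetCard 3, #{x ∈ S \ T | #{s ∈ (S \ T).erase x | side T s} = k} =
      (#S - 3 - k) * (if #{s ∈ S \ T | side T s} = k then 1 else 0) +
        (k + 1) * (if #{s ∈ S \ T | side T s} = k + 1 then 1 else 0) := by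
    intro T hT
    obtain ⟨hTS, hT3⟩ := mem_powersetCard.1 hT
    have hc : #(S \ T) = #S - 3 := by rw [card_sdiff_of_subset hTS, hT3]
    have hsplit := card_filter_add_card_filter_not (s := S \ T) (side T)
    have herase : ∀ x ∈ S \ T, #{s ∈ (S \ T).erase x | side T s} =
        if side T x then #{s ∈ S \ T | side T s} - 1 else #{s ∈ S \ T | side T s} := by
      intro x hx
      rw [filter_erase]
      split_ifs with h
      · rw [card_erase_of_mem (by simp_all)]
      · rw [erase_eq_of_notMem (by simp_all)]
    have hpos : ∀ x ∈ S \ T, side T x → 0 < #{s ∈ S \ T | side T s} := fun x hx h =>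
      card_pos.2 ⟨x, mem_filter.2 ⟨hx, h⟩⟩
    by_cases h1 : #{s ∈ S \ T | side T s} = k
    · have h1' : #{s ∈ S \ T | side T s} ≠ k + 1 := by omega
      have : {x ∈ S \ T | #{s ∈ (S \ T).erase x | side T s} = k} =
          {x ∈ S \ T | ¬ side T x} := by
        refine filter_congr fun x hx => ?_
        rw [herase x hx]
        have := hpos x hx
        split_ifs with h
        · have := this h
          simp only [h, not_true, iff_false]; omega
        · simp [h, h1]
      rw [this, if_pos h1, if_neg h1', mul_one, mul_zero, add_zero]
      rw [h1, hc] at hsplit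
      exact Nat.eq_sub_of_add_eq' hsplit
    by_cases h2 : #{s ∈ S \ T | side T s} = k + 1
    · have : {x ∈ S \ T | #{s ∈ (S \ T).erase x | side T s} = k} =
          {x ∈ S \ T | side T x} := by
        refine filter_congr fun x hx => ?_
        rw [herase x hx]
        split_ifs with h
        · simp [h, h2]
        · simp [h, h2]
      rw [this]
      simp [h2]
    · rw [if_neg h1, if_neg h2, card_eq_zero.2]
      · simp
      · refine filter_eq_empty_iff.2 fun x hx => ?_
        rw [herase x hx]
        have := hpos x hx
        split_ifs with h
        · have := this h
          omega
        · exact h1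
  rw [hswap, sum_congr rfl hT, sum_add_distrib, ← mul_sum, ← mul_sum, facetCount, facetCount,
    card_filter, card_filter]

theorem facetCount_add_facetCount {α : Type*} [DecidableEq α] (side side' : Finset α → α → Prop)
    [∀ T, DecidablePred (side T)] [∀ T, DecidablePred (side' T)] (S : Finset α)
    (h0 : ∀ A ⊆ S, 2 ≤ #A → facetCount side A 0 + facetCount side' A 0 = 2 * (#A - 2))
    (k : ℕ) : ∀ A ⊆ S, k + 3 ≤ #A →
      facetCount side A k + facetCount side' A k = 2 * (k + 1) * (#A - k - 2) := by
  induction k with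
  | zero => intro A hA hc; rw [h0 A hA (by omega)]; simp
  | succ k ih =>
    intro A hA hc
    have h1 := sum_facetCount_erase side A k
    have h2 := sum_facetCount_erase side' A k
    have h3 := ih A hA (by omega)
    have h4 : ∑ x ∈ A, (facetCount side (A.erase x) k + facetCount side' (A.erase x) k) =
        ∑ x ∈ A, 2 * (k + 1) * (#A - 1 - k - 2) := by
      refine sum_congr rfl fun x hx => ?_
      rw [ih _ ((erase_subset _ _).trans hA) (by rw [card_erase_of_mem hx]; omega),
        card_erase_of_mem hx]
    rw [sum_add_distrib, h1, h2, sum_const, smul_eq_mul] at h4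
    obtain ⟨m, hm⟩ := Nat.exists_eq_add_of_le hc
    have e1 : #A - 3 - k = m + 1 := by omega
    have e2 : #A - k - 2 = m + 2 := by omega
    have e3 : #A - 1 - k - 2 = m + 1 := by omega
    have e4 : #A - (k + 1) - 2 = m + 1 := by omega
    rw [e1, e3] at h4
    rw [e2] at h3
    rw [e4]
    refine Nat.eq_of_mul_eq_mul_left (Nat.succ_pos k) ?_
    rw [hm] at h4
    zify at *
    linear_combination h4 - (m + 1 : ℤ) * h3

theorem sum_powersetCard_three {α : Type*} [DecidableEq α] (f : α → ℝ) (S : Finset α)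
    (hf : Set.InjOn f S) (φ : Finset α → ℕ) :
    ∑ T ∈ S.powersetCard 3, φ T =
      ∑ v ∈ S, ∑ pq ∈ {p ∈ S | f p < f v} ×ˢ {q ∈ S | f v < f q}, φ {pq.1, v, pq.2} := by
  rw [sum_sigma']
  symm
  refine sum_nbij (fun x => {x.2.1, x.1, x.2.2}) ?_ ?_ ?_ (fun _ _ => rfl)
  · rintro ⟨v, p, q⟩ h
    simp only [mem_sigma, mem_product, mem_filter] at h
    obtain ⟨hv, ⟨hp, hpv⟩, hq, hvq⟩ := h
    rw [mem_powersetCard]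
    constructor
    · simp [insert_subset_iff, hv, hp, hq]
    · refine card_eq_three.2 ⟨p, v, q, ?_, ?_, ?_, rfl⟩ <;> rintro rfl <;> linarith
  · rintro ⟨v, p, q⟩ h ⟨v', p', q'⟩ h' heq
    simp only [coe_sigma, Set.mem_sigma_iff, mem_coe, mem_product, mem_filter] at h h'
    obtain ⟨hv, ⟨hp, hpv⟩, hq, hvq⟩ := h
    obtain ⟨hv', ⟨hp', hpv'⟩, hq', hvq'⟩ := h'
    dsimp only at heq
    have a1 : p ∈ ({p', v', q'} : Finset α) := by rw [← heq]; simp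
    have a2 : v ∈ ({p', v', q'} : Finset α) := by rw [← heq]; simp
    have a3 : q ∈ ({p', v', q'} : Finset α) := by rw [← heq]; simp
    simp only [mem_insert, mem_singleton] at a1 a2 a3
    have : v = v' ∧ p = p' ∧ q = q' := by
      rcases a1 with rfl | rfl | rfl <;> rcases a2 with rfl | rfl | rfl <;>
        rcases a3 with rfl | rfl | rfl <;> first | exact ⟨rfl, rfl, rfl⟩ | (exfalso; linarith)
    obtain ⟨rfl, rfl, rfl⟩ := this
    rfl
  · intro T hT
    obtain ⟨hTS, hT3⟩ := mem_powersetCard.1 hT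
    have hsort : ∃ a b c, f a < f b ∧ f b < f c ∧ T = {a, b, c} := by
      obtain ⟨x, y, z, hxy, hxz, hyz, rfl⟩ := card_eq_three.1 hT3
      have hne : ∀ s ∈ ({x, y, z} : Finset α), ∀ t ∈ ({x, y, z} : Finset α), s ≠ t → f s ≠ f t :=
        fun s hs t ht h e => h (hf (hTS hs) (hTS ht) e)
      rcases lt_or_gt_of_ne (hne x (by simp) y (by simp) hxy) with h1 | h1 <;>
      rcases lt_or_gt_of_ne (hne x (by simp) z (by simp) hxz) with h2 | h2 <;>
      rcases lt_or_gt_of_ne (hne y (by simp) z (by simp) hyz) with h3 | h3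
      · exact ⟨x, y, z, h1, h3, rfl⟩
      · exact ⟨x, z, y, h2, h3, by grind⟩
      · linarith
      · exact ⟨z, x, y, h2, h1, by grind⟩
      · exact ⟨y, x, z, h1, h2, by grind⟩
      · linarith
      · exact ⟨y, z, x, h3, h2, by grind⟩
      · exact ⟨z, y, x, h3, h1, by grind⟩
    obtain ⟨a, b, c, hab, hbc, rfl⟩ := hsort
    refine ⟨⟨b, a, c⟩, ?_, rfl⟩
    simp only [coe_sigma, Set.mem_sigma_iff, mem_coe, mem_product, mem_filter]
    exact ⟨hTS (by simp), ⟨hTS (by simp), hab⟩, hTS (by simp), hbc⟩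

theorem card_filter_exists_lt_exists_gt {α : Type*} [DecidableEq α] (f : α → ℝ) (S : Finset α)
    (hf : Set.InjOn f S) (hS : 2 ≤ #S) :
    #{v ∈ S | {p ∈ S | f p < f v}.Nonempty ∧ {q ∈ S | f v < f q}.Nonempty} = #S - 2 := by
  have hne : S.Nonempty := card_pos.1 (by omega)
  obtain ⟨a, ha, hmin⟩ := exists_min_image S f hne
  obtain ⟨b, hb, hmax⟩ := exists_max_image S f hne
  have hab : a ≠ b := by
    rintro rfl
    obtain ⟨x, hx, y, hy, hxy⟩ := one_lt_card.1 hS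
    exact hxy (hf hx hy (by linarith [hmin x hx, hmax x hx, hmin y hy, hmax y hy]))
  have : {v ∈ S | {p ∈ S | f p < f v}.Nonempty ∧ {q ∈ S | f v < f q}.Nonempty} =
      (S.erase a).erase b := by
    ext v
    simp only [mem_filter, mem_erase]
    constructor
    · rintro ⟨hv, ⟨p, hp⟩, ⟨q, hq⟩⟩
      rw [mem_filter] at hp hq
      refine ⟨?_, ?_, hv⟩ <;> rintro rfl
      · linarith [hmax q hq.1]
      · linarith [hmin p hp.1]
    · rintro ⟨hvb, hva, hv⟩
      refine ⟨hv, ⟨a, mem_filter.2 ⟨ha, ?_⟩⟩, ⟨b, mem_filter.2 ⟨hb, ?_⟩⟩⟩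
      · exact lt_of_le_of_ne (hmin v hv) fun e => hva (hf hv ha e.symm)
      · exact lt_of_le_of_ne (hmax v hv) fun e => hvb (hf hv hb e)
  rw [this, card_erase_of_mem (mem_erase.2 ⟨hab.symm, hb⟩), card_erase_of_mem ha]
  omega

/-- The first coordinate of the inversion at `v` of the point `s`, in a frame rotated along
`(a, b)`. -/
noncomputable def invCoordX (a b : ℝ) (v s : EuclideanSpace ℝ (Fin 2)) : ℝ :=
  (a * (s 0 - v 0) + b * (s 1 - v 1)) / dist s v ^ 2

/-- The second coordinate of the inversion at `v` of the point `s`, in a frame rotated along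
`(a, b)`. -/
noncomputable def invCoordY (a b : ℝ) (v s : EuclideanSpace ℝ (Fin 2)) : ℝ :=
  (-b * (s 0 - v 0) + a * (s 1 - v 1)) / dist s v ^ 2

theorem dist_sq_eq_coord (x y : EuclideanSpace ℝ (Fin 2)) :
    dist x y ^ 2 = (x 0 - y 0) ^ 2 + (x 1 - y 1) ^ 2 := by
  rw [EuclideanSpace.dist_eq, Real.sq_sqrt (by positivity), Fin.sum_univ_two, Real.dist_eq,
    Real.dist_eq, sq_abs, sq_abs]

theorem exists_power_eq_affine_invCoord {a b : ℝ} (hab : a ^ 2 + b ^ 2 ≠ 0)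
    {v c : EuclideanSpace ℝ (Fin 2)} {r : ℝ} (hv : dist v c = r) :
    ∃ α β : ℝ, ∀ s ≠ v, dist s c ^ 2 - r ^ 2 =
      dist s v ^ 2 * (1 - α * invCoordX a b v s - β * invCoordY a b v s) := by
  refine ⟨2 * (a * (c 0 - v 0) + b * (c 1 - v 1)) / (a ^ 2 + b ^ 2),
    2 * (-b * (c 0 - v 0) + a * (c 1 - v 1)) / (a ^ 2 + b ^ 2), fun s hs => ?_⟩
  have hd : dist s v ^ 2 ≠ 0 := pow_ne_zero 2 (dist_ne_zero.2 hs)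
  have hX : dist s v ^ 2 * invCoordX a b v s = a * (s 0 - v 0) + b * (s 1 - v 1) :=
    mul_div_cancel₀ _ hd
  have hY : dist s v ^ 2 * invCoordY a b v s = -b * (s 0 - v 0) + a * (s 1 - v 1) :=
    mul_div_cancel₀ _ hd
  rw [mul_sub, mul_sub, mul_one, mul_left_comm _ _ (invCoordX a b v s), hX,
    mul_left_comm _ _ (invCoordY a b v s), hY, ← hv, dist_sq_eq_coord, dist_sq_eq_coord,
    dist_sq_eq_coord]
  field_simp
  ring

theorem exists_le_dist_iff_signedArea {a b : ℝ} {v p q c : EuclideanSpace ℝ (Fin 2)} {r : ℝ}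
    (hv : dist v c = r) (hp : dist p c = r) (hq : dist q c = r)
    (hpv : a * p 0 + b * p 1 < a * v 0 + b * v 1)
    (hvq : a * v 0 + b * v 1 < a * q 0 + b * q 1) :
    ∃ β : ℝ, β ≠ 0 ∧ ∀ s ≠ v,
      (r ≤ dist s c ↔ β * signedArea (invCoordX a b v) (invCoordY a b v) p q s ≤ 0) ∧
      (dist s c ≤ r ↔ 0 ≤ β * signedArea (invCoordX a b v) (invCoordY a b v) p q s) := by
  have hab : a ^ 2 + b ^ 2 ≠ 0 := by
    intro h
    have ha : a = 0 := by nlinarith [sq_nonneg a, sq_nonneg b]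
    have hb : b = 0 := by nlinarith [sq_nonneg a, sq_nonneg b]
    simp [ha, hb] at hpv
  have hpne : p ≠ v := by rintro rfl; exact lt_irrefl _ hpv
  have hqne : q ≠ v := by rintro rfl; exact lt_irrefl _ hvq
  obtain ⟨α, β, h⟩ := exists_power_eq_affine_invCoord hab hv
  have hpos : ∀ s ≠ v, 0 < dist s v ^ 2 := fun s hs => pow_pos (dist_pos.2 hs) 2
  have hXp : invCoordX a b v p < 0 := div_neg_of_neg_of_pos (by linarith) (hpos p hpne)
  have hXq : 0 < invCoordX a b v q := div_pos (by linarith) (hpos q hqne)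
  have hon : ∀ s ≠ v, dist s c = r →
      1 - α * invCoordX a b v s - β * invCoordY a b v s = 0 := by
    intro s hs hsr
    have := h s hs
    rw [hsr, sub_self] at this
    exact (mul_eq_zero.1 this.symm).resolve_left (hpos s hs).ne'
  have hp0 := hon p hpne hp
  have hq0 := hon q hqne hq
  refine ⟨β, ?_, fun s hs => ?_⟩
  · rintro rfl
    have : α * (invCoordX a b v q - invCoordX a b v p) = 0 := by linarith
    rcases mul_eq_zero.1 this with rfl | h0
    · linarith
    · linarith
  · have hr : 0 ≤ r := hv ▸ dist_nonneg
    have key : dist s v ^ 2 * (β * signedArea (invCoordX a b v) (invCoordY a b v) p q s) =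
        -((invCoordX a b v q - invCoordX a b v p) * (dist s c ^ 2 - r ^ 2)) := by
      rw [h s hs]
      unfold signedArea
      linear_combination dist s v ^ 2 * ((invCoordX a b v q - invCoordX a b v s) * hp0
        + (invCoordX a b v s - invCoordX a b v p) * hq0)
    have hX : 0 < invCoordX a b v q - invCoordX a b v p := by linarith
    constructor
    · rw [← sq_le_sq₀ hr dist_nonneg, ← sub_nonneg, ← mul_nonneg_iff_of_pos_left hX,
        ← neg_nonpos, ← key, ← neg_nonneg, ← mul_neg, mul_nonneg_iff_of_pos_left (hpos s hs),
        neg_nonneg]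
    · rw [← sq_le_sq₀ dist_nonneg hr, ← sub_nonpos, ← neg_nonneg,
        ← mul_nonneg_iff_of_pos_left hX, mul_neg, ← key, mul_nonneg_iff_of_pos_left (hpos s hs)]

theorem exists_injOn_linear (A : Finset (EuclideanSpace ℝ (Fin 2))) :
    ∃ a b : ℝ, Set.InjOn (fun x : EuclideanSpace ℝ (Fin 2) => a * x 0 + b * x 1) A := by
  obtain ⟨f, hf⟩ := Module.exists_dual_forall_apply_ne_zero (K := ℝ)
    (fun x : A.offDiag => x.1.1 - x.1.2)
    (fun x => sub_ne_zero.2 (mem_offDiag.1 x.2).2.2)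
  refine ⟨f (EuclideanSpace.single 0 1), f (EuclideanSpace.single 1 1), fun x hx y hy hxy => ?_⟩
  have hcoord : ∀ x : EuclideanSpace ℝ (Fin 2),
      f x = f (EuclideanSpace.single 0 1) * x 0 + f (EuclideanSpace.single 1 1) * x 1 := by
    intro x
    have : x = x 0 • EuclideanSpace.single 0 1 + x 1 • EuclideanSpace.single 1 1 := by
      ext i; fin_cases i <;> simp
    conv_lhs => rw [this]
    simp [mul_comm]
  by_contra hne
  refine hf ⟨(x, y), mem_offDiag.2 ⟨hx, hy, hne⟩⟩ ?_
  dsimp only at hxy ⊢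
  rw [map_sub, hcoord x, hcoord y, hxy, sub_self]

open scoped Classical in
theorem facetCount_zero_add_facetCount_zero (A : Finset (EuclideanSpace ℝ (Fin 2)))
    (c : Finset (EuclideanSpace ℝ (Fin 2)) → EuclideanSpace ℝ (Fin 2))
    (r : Finset (EuclideanSpace ℝ (Fin 2)) → ℝ)
    (hon : ∀ T ⊆ A, #T = 3 → ∀ t ∈ T, dist t (c T) = r T)
    (hoff : ∀ T ⊆ A, #T = 3 → ∀ s ∈ A, dist s (c T) = r T → s ∈ T) (hA : 2 ≤ #A) :
    facetCount (fun T s => dist s (c T) < r T) A 0 +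
      facetCount (fun T s => r T < dist s (c T)) A 0 = 2 * (#A - 2) := by
  obtain ⟨a, b, hf⟩ := exists_injOn_linear A
  set f := fun x : EuclideanSpace ℝ (Fin 2) => a * x 0 + b * x 1 with hfdef
  unfold facetCount
  rw [card_filter, card_filter, ← sum_add_distrib, sum_powersetCard_three f A hf,
    ← card_filter_exists_lt_exists_gt f A hf hA, card_filter, mul_sum]
  refine sum_congr rfl fun v hv => ?_
  set L := {p ∈ A | f p < f v} with hLdef
  set R := {q ∈ A | f v < f q} with hRdef
  split_ifs with hLR
  swap
  · rw [mul_zero]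
    refine sum_eq_zero ?_
    rintro ⟨p, q⟩ hpq
    rw [mem_product] at hpq
    exact (hLR ⟨⟨p, hpq.1⟩, ⟨q, hpq.2⟩⟩).elim
  have hLR' : L ∪ R = A.erase v := by
    ext s
    simp only [hLdef, hRdef, mem_union, mem_filter, mem_erase]
    constructor
    · rintro (⟨h1, h2⟩ | ⟨h1, h2⟩) <;> refine ⟨?_, h1⟩ <;> rintro rfl <;> exact lt_irrefl _ h2
    · rintro ⟨h1, h2⟩
      rcases lt_or_gt_of_ne (fun h => h1 (hf h2 hv h)) with h | h
      · exact Or.inl ⟨h2, h⟩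
      · exact Or.inr ⟨h2, h⟩
  set X := invCoordX a b v
  set Y := invCoordY a b v
  have hneg : ∀ p q s, signedArea X (fun x => -Y x) p q s = -signedArea X Y p q s := by
    intro p q s; unfold signedArea; ring
  have hpos : ∀ s ∈ A.erase v, 0 < dist s v ^ 2 := fun s hs =>
    pow_pos (dist_pos.2 (mem_erase.1 hs).1) 2
  have hXL : ∀ p ∈ L, X p < 0 := by
    intro p hp
    have h := (mem_filter.1 hp).2
    refine div_neg_of_neg_of_pos ?_ (hpos p (hLR' ▸ mem_union_left _ hp))
    simp only [hfdef] at h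
    linarith
  have hXR : ∀ q ∈ R, 0 < X q := by
    intro q hq
    have h := (mem_filter.1 hq).2
    refine div_pos ?_ (hpos q (hLR' ▸ mem_union_right _ hq))
    simp only [hfdef] at h
    linarith
  have hmain : ∀ p ∈ L, ∀ q ∈ R, {p, v, q} ⊆ A ∧ #{p, v, q} = 3 ∧ ∃ β : ℝ, β ≠ 0 ∧ ∀ s ≠ v,
      (r {p, v, q} ≤ dist s (c {p, v, q}) ↔ β * signedArea X Y p q s ≤ 0) ∧
      (dist s (c {p, v, q}) ≤ r {p, v, q} ↔ 0 ≤ β * signedArea X Y p q s) := by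
    intro p hp q hq
    obtain ⟨hpA, hpv⟩ := mem_filter.1 hp
    obtain ⟨hqA, hvq⟩ := mem_filter.1 hq
    have hTA : {p, v, q} ⊆ A := by simp [insert_subset_iff, hpA, hv, hqA]
    have hT3 : #{p, v, q} = 3 := by
      refine card_eq_three.2 ⟨p, v, q, ?_, ?_, ?_, rfl⟩ <;> rintro rfl <;> linarith
    exact ⟨hTA, hT3, exists_le_dist_iff_signedArea (hon _ hTA hT3 v (by simp))
      (hon _ hTA hT3 p (by simp)) (hon _ hTA hT3 q (by simp)) hpv hvq⟩
  have hgen : ∀ p ∈ L, ∀ q ∈ R, ∀ s ∈ L ∪ R, signedArea X Y p q s = 0 → s = p ∨ s = q := by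
    intro p hp q hq s hs h0
    obtain ⟨hTA, hT3, β, -, hβ⟩ := hmain p hp q hq
    rw [hLR', mem_erase] at hs
    obtain ⟨h1, h2⟩ := hβ s hs.1
    rw [h0, mul_zero] at h1 h2
    have := hoff _ hTA hT3 s hs.2 (le_antisymm (h2.2 le_rfl) (h1.2 le_rfl))
    simp only [mem_insert, mem_singleton] at this
    tauto
  have hup := card_supporting_pairs_eq_one hLR.1 hLR.2 hXL hXR hgen
  have hlow := card_supporting_pairs_eq_one (Y := fun x => -Y x) hLR.1 hLR.2 hXL hXR
    (fun p hp q hq s hs h => hgen p hp q hq s hs (by rw [hneg] at h; linarith))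
  rw [card_filter] at hup hlow
  rw [show 2 * 1 = _ + _ from (congrArg₂ (· + ·) hup hlow).symm, ← sum_add_distrib]
  refine sum_congr rfl ?_
  rintro ⟨p, q⟩ hpq
  obtain ⟨hp, hq⟩ := mem_product.1 hpq
  obtain ⟨hTA, hT3, β, hβ0, hβ⟩ := hmain p hp q hq
  dsimp only
  have hp0 : signedArea X Y p q p = 0 := by unfold signedArea; ring
  have hq0 : signedArea X Y p q q = 0 := by unfold signedArea; ring
  have hext : ∀ P : ℝ → Prop, P 0 → ((∀ s ∈ A \ {p, v, q}, P (signedArea X Y p q s)) ↔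
      ∀ s ∈ L ∪ R, P (signedArea X Y p q s)) := by
    intro P h0
    rw [hLR']
    constructor
    · intro h s hs
      by_cases hsp : s = p
      · rw [hsp, hp0]; exact h0
      by_cases hsq : s = q
      · rw [hsq, hq0]; exact h0
      · rw [mem_erase] at hs
        exact h s (by simp [hs, hsp, hsq])
    · intro h s hs
      simp only [mem_sdiff, mem_insert, mem_singleton, not_or] at hs
      exact h s (mem_erase.2 ⟨hs.2.2.1, hs.1⟩)
  have hin : #{s ∈ A \ {p, v, q} | dist s (c {p, v, q}) < r {p, v, q}} = 0 ↔
      ∀ s ∈ L ∪ R, β * signedArea X Y p q s ≤ 0 := by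
    rw [← hext (fun t => β * t ≤ 0) (by simp), card_eq_zero, filter_eq_empty_iff]
    refine forall₂_congr fun s hs => ?_
    rw [not_lt]
    exact (hβ s (by rintro rfl; simp at hs)).1
  have hout : #{s ∈ A \ {p, v, q} | r {p, v, q} < dist s (c {p, v, q})} = 0 ↔
      ∀ s ∈ L ∪ R, 0 ≤ β * signedArea X Y p q s := by
    rw [← hext (fun t => 0 ≤ β * t) (by simp), card_eq_zero, filter_eq_empty_iff]
    refine forall₂_congr fun s hs => ?_
    rw [not_lt]
    exact (hβ s (by rintro rfl; simp at hs)).2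
  simp only [hin, hout, hneg]
  rcases lt_or_gt_of_ne hβ0 with hβneg | hβpos
  · rw [add_comm]
    simp only [mul_nonneg_iff, mul_nonpos_iff, hβneg.le, hβneg.not_ge, true_and, false_and,
      false_or, neg_nonpos]
  · simp only [mul_nonpos_iff, mul_nonneg_iff, hβpos.le, hβpos.not_ge, true_and, false_and,
      or_false, neg_nonpos]

theorem existsUnique_circle {T : Finset (EuclideanSpace ℝ (Fin 2))} (hT : #T = 3)
    (hind : AffineIndependent ℝ
      (fun t : (T : Set (EuclideanSpace ℝ (Fin 2))) => (t : EuclideanSpace ℝ (Fin 2)))) :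
    ∃! cs : EuclideanGeometry.Sphere (EuclideanSpace ℝ (Fin 2)),
      ∀ t ∈ T, dist t cs.center = cs.radius := by
  obtain ⟨x, hx⟩ := card_pos.1 (by omega : 0 < #T)
  have : Nonempty (T : Set (EuclideanSpace ℝ (Fin 2))) := ⟨⟨x, hx⟩⟩
  have htop := hind.affineSpan_eq_top_iff_card_eq_finrank_add_one.2 (by simp [hT])
  refine (existsUnique_congr fun cs => ?_).1 hind.existsUnique_dist_eq
  rw [htop, Subtype.range_coe]
  exact ⟨fun h t ht => h.2 ht, fun h => ⟨AffineSubspace.mem_top _ _ _, h⟩⟩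

theorem radius_pos_of_card_eq_three {T : Finset (EuclideanSpace ℝ (Fin 2))} (hT : #T = 3)
    {c : EuclideanSpace ℝ (Fin 2)} {r : ℝ} (h : ∀ t ∈ T, dist t c = r) : 0 < r := by
  obtain ⟨x, hx, y, hy, hxy⟩ := one_lt_card.1 (by omega : 1 < #T)
  by_contra hr
  have hx0 : dist x c ≤ 0 := (h x hx).trans_le (not_lt.1 hr)
  have hy0 : dist y c ≤ 0 := (h y hy).trans_le (not_lt.1 hr)
  exact hxy ((dist_le_zero.1 hx0).trans (dist_le_zero.1 hy0).symm)

theorem mem_of_dist_eq_of_ncard_le_three {S T : Finset (EuclideanSpace ℝ (Fin 2))}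
    {z : EuclideanSpace ℝ (Fin 2)} {r : ℝ}
    (hgen : Set.ncard {s : EuclideanSpace ℝ (Fin 2) | s ∈ S ∧ dist s z = r} ≤ 3)
    (hTS : T ⊆ S) (hT : #T = 3) (hon : ∀ t ∈ T, dist t z = r) {s : EuclideanSpace ℝ (Fin 2)}
    (hs : s ∈ S) (hsr : dist s z = r) : s ∈ T := by
  classical
  by_contra hsT
  have hsub : ((insert s T : Finset _) : Set (EuclideanSpace ℝ (Fin 2))) ⊆
      {s | s ∈ S ∧ dist s z = r} := by
    intro t ht
    rcases mem_insert.1 (mem_coe.1 ht) with rfl | ht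
    · exact ⟨hs, hsr⟩
    · exact ⟨hTS ht, hon t ht⟩
  have h := Set.ncard_le_ncard hsub (S.finite_toSet.subset fun t ht => ht.1)
  rw [Set.ncard_coe_finset, card_insert_of_notMem hsT, hT] at h
  omega

/-- Exact count of circle `k`-facets (Ardila; Lee).  Let `S` be a set of `2n+1` points
in the plane in general position: no three collinear and no four concyclic.  Then for
every `0 ≤ k ≤ 2n-2`, the number of pairs `(T, O)`, where `T ⊆ S` has exactly 3
elements and `O` is the open disk or the open exterior of the unique circle through the
three points of `T`, such that `O` contains exactly `k` points of `S \ T`, is exactly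
`2(k+1)(2n-k-1)`.  In particular, the number of (distinct, unoriented) halving circles,
i.e. circles through 3 points of `S` with `n-1` points inside and `n-1` points outside,
is exactly `n²`. -/
theorem circle_kfacet_count (n : ℕ) (hn : 1 ≤ n)
    (S : Finset (EuclideanSpace ℝ (Fin 2))) (hcard : S.card = 2 * n + 1)
    (hgen1 : ∀ T ⊆ S, T.card ≤ 3 →
      AffineIndependent ℝ
        (fun t : (T : Set (EuclideanSpace ℝ (Fin 2))) => (t : EuclideanSpace ℝ (Fin 2))))
    (hgen2 : ∀ z : EuclideanSpace ℝ (Fin 2), ∀ r : ℝ,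
      Set.ncard {s : EuclideanSpace ℝ (Fin 2) | s ∈ S ∧ dist s z = r} ≤ 3) :
    (∀ k : ℕ, k ≤ 2 * n - 2 →
      Set.ncard {TO : Finset (EuclideanSpace ℝ (Fin 2)) × Set (EuclideanSpace ℝ (Fin 2)) |
        TO.1 ⊆ S ∧ TO.1.card = 3 ∧
        (∃ (z : EuclideanSpace ℝ (Fin 2)) (r : ℝ), 0 < r ∧
          (∀ t ∈ TO.1, dist t z = r) ∧
          (TO.2 = {x : EuclideanSpace ℝ (Fin 2) | dist x z < r} ∨
            TO.2 = {x : EuclideanSpace ℝ (Fin 2) | r < dist x z})) ∧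
        Set.ncard {s : EuclideanSpace ℝ (Fin 2) | s ∈ S ∧ s ∉ TO.1 ∧ s ∈ TO.2} = k} =
      2 * (k + 1) * (2 * n - k - 1)) ∧
    Set.ncard {zr : EuclideanSpace ℝ (Fin 2) × ℝ | 0 < zr.2 ∧
        Set.ncard {s : EuclideanSpace ℝ (Fin 2) | s ∈ S ∧ dist s zr.1 = zr.2} = 3 ∧
        Set.ncard {s : EuclideanSpace ℝ (Fin 2) | s ∈ S ∧ dist s zr.1 < zr.2} = n - 1 ∧
        Set.ncard {s : EuclideanSpace ℝ (Fin 2) | s ∈ S ∧ zr.2 < dist s zr.1} = n - 1} =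
      n ^ 2 := by
  classical
  have hex : ∀ T : Finset (EuclideanSpace ℝ (Fin 2)),
      ∃ cs : EuclideanGeometry.Sphere (EuclideanSpace ℝ (Fin 2)), T ⊆ S → #T = 3 →
        (∀ t ∈ T, dist t cs.center = cs.radius) ∧
          ∀ z r, (∀ t ∈ T, dist t z = r) → z = cs.center ∧ r = cs.radius := by
    intro T
    by_cases h : T ⊆ S ∧ #T = 3
    · obtain ⟨cs, h1, h2⟩ := existsUnique_circle h.2 (hgen1 T h.1 h.2.le)
      refine ⟨cs, fun _ _ => ⟨h1, fun z r hzr => ?_⟩⟩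
      have := h2 ⟨z, r⟩ hzr
      exact ⟨congrArg (·.center) this, congrArg (·.radius) this⟩
    · exact ⟨⟨0, 0⟩, fun h1 h2 => (h ⟨h1, h2⟩).elim⟩
  choose cs hcs using hex
  set c := fun T => (cs T).center
  set r := fun T => (cs T).radius
  have hon : ∀ T ⊆ S, #T = 3 → ∀ t ∈ T, dist t (c T) = r T := fun T h1 h2 => (hcs T h1 h2).1
  have huniq : ∀ T ⊆ S, #T = 3 → ∀ z ρ, (∀ t ∈ T, dist t z = ρ) → z = c T ∧ ρ = r T :=
    fun T h1 h2 => (hcs T h1 h2).2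
  have hoff : ∀ T ⊆ S, #T = 3 → ∀ s ∈ S, dist s (c T) = r T → s ∈ T := fun T h1 h2 s hs hsr =>
    mem_of_dist_eq_of_ncard_le_three (hgen2 (c T) (r T)) h1 h2 (hon T h1 h2) hs hsr
  have hrpos : ∀ T ⊆ S, #T = 3 → 0 < r T := fun T h1 h2 =>
    radius_pos_of_card_eq_three h2 (hon T h1 h2)
  clear_value c r
  have hcount : ∀ k, k + 3 ≤ #S → facetCount (fun T s => dist s (c T) < r T) S k +
      facetCount (fun T s => r T < dist s (c T)) S k = 2 * (k + 1) * (#S - k - 2) := by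
    intro k hk
    refine facetCount_add_facetCount _ _ S (fun A hA hA2 => ?_) k S subset_rfl hk
    exact facetCount_zero_add_facetCount_zero A c r (fun T hT => hon T (hT.trans hA))
      (fun T hT h3 s hs => hoff T (hT.trans hA) h3 s (hA hs)) hA2
  have hside : ∀ (T : Finset (EuclideanSpace ℝ (Fin 2))) (P : EuclideanSpace ℝ (Fin 2) → Prop),
      Set.ncard {s : EuclideanSpace ℝ (Fin 2) | s ∈ S ∧ s ∉ T ∧ P s} = #{s ∈ S \ T | P s} := by
    intro T P
    rw [← Set.ncard_coe_finset]
    congr 1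
    ext s
    simp [and_assoc]
  refine ⟨fun k hk => ?_, ?_⟩
  · have hset : {TO : Finset (EuclideanSpace ℝ (Fin 2)) × Set (EuclideanSpace ℝ (Fin 2)) |
        TO.1 ⊆ S ∧ TO.1.card = 3 ∧
        (∃ (z : EuclideanSpace ℝ (Fin 2)) (r : ℝ), 0 < r ∧
          (∀ t ∈ TO.1, dist t z = r) ∧
          (TO.2 = {x : EuclideanSpace ℝ (Fin 2) | dist x z < r} ∨
            TO.2 = {x : EuclideanSpace ℝ (Fin 2) | r < dist x z})) ∧
        Set.ncard {s : EuclideanSpace ℝ (Fin 2) | s ∈ S ∧ s ∉ TO.1 ∧ s ∈ TO.2} = k} =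
        (fun T => (T, {x | dist x (c T) < r T})) ''
          {T ∈ S.powersetCard 3 | #{s ∈ S \ T | dist s (c T) < r T} = k} ∪
        (fun T => (T, {x | r T < dist x (c T)})) ''
          {T ∈ S.powersetCard 3 | #{s ∈ S \ T | r T < dist s (c T)} = k} := by
      ext ⟨T, O⟩
      simp only [Set.mem_ofPred_eq, Set.mem_union, Set.mem_image, mem_powersetCard,
        Prod.mk.injEq]
      constructor
      · rintro ⟨hTS, hT3, ⟨z, ρ, hρ, hzρ, hO⟩, hk⟩
        obtain ⟨rfl, rfl⟩ := huniq T hTS hT3 z ρ hzρ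
        rw [hside T (· ∈ O)] at hk
        rcases hO with rfl | rfl
        · exact Or.inl ⟨T, ⟨⟨hTS, hT3⟩, hk⟩, rfl, rfl⟩
        · exact Or.inr ⟨T, ⟨⟨hTS, hT3⟩, hk⟩, rfl, rfl⟩
      · rintro (⟨T, ⟨⟨hTS, hT3⟩, hk⟩, rfl, rfl⟩ | ⟨T, ⟨⟨hTS, hT3⟩, hk⟩, rfl, rfl⟩)
        · exact ⟨hTS, hT3, ⟨c T, r T, hrpos T hTS hT3, hon T hTS hT3, Or.inl rfl⟩,
            (hside T _).trans hk⟩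
        · exact ⟨hTS, hT3, ⟨c T, r T, hrpos T hTS hT3, hon T hTS hT3, Or.inr rfl⟩,
            (hside T _).trans hk⟩
    have hcoe : ∀ (P : Finset (EuclideanSpace ℝ (Fin 2)) → Prop) [DecidablePred P],
        {T | T ∈ S.powersetCard 3 ∧ P T} = ({T ∈ S.powersetCard 3 | P T} : Finset _) := by
      intro P _; ext; simp
    rw [hset, hcoe, hcoe, Set.ncard_union_eq ?_ (Set.toFinite _) (Set.toFinite _),
      Set.ncard_image_of_injective _ fun _ _ h => congrArg Prod.fst h,
      Set.ncard_image_of_injective _ fun _ _ h => congrArg Prod.fst h,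
      Set.ncard_coe_finset, Set.ncard_coe_finset]
    · have h := hcount k (by omega)
      rw [hcard, show 2 * n + 1 - k - 2 = 2 * n - k - 1 by omega] at h
      exact h
    · rw [Set.disjoint_left]
      rintro _ ⟨T, hT, rfl⟩ ⟨T', -, h⟩
      obtain ⟨rfl, h2⟩ := Prod.mk.inj h
      obtain ⟨hTS, hT3⟩ := mem_powersetCard.1 (mem_filter.1 (mem_coe.1 hT)).1
      have hpos := hrpos _ hTS hT3
      have hmem : c T' ∈ {x | dist x (c T') < r T'} := by simpa using hpos
      rw [← h2] at hmem
      simp only [Set.mem_ofPred_eq, dist_self] at hmem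
      exact hpos.not_gt hmem
  · have hsum : ∀ T ∈ S.powersetCard 3, #{s ∈ S \ T | dist s (c T) < r T} +
        #{s ∈ S \ T | r T < dist s (c T)} = 2 * n - 2 := by
      intro T hT
      obtain ⟨hTS, hT3⟩ := mem_powersetCard.1 hT
      have h := card_filter_add_card_filter_not (s := S \ T) (fun s => dist s (c T) < r T)
      rw [card_sdiff_of_subset hTS, hT3, hcard] at h
      rw [show 2 * n - 2 = 2 * n + 1 - 3 by omega, ← h]
      congr 2
      refine filter_congr fun s hs => ?_
      rw [mem_sdiff] at hs
      rw [not_lt]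
      exact ⟨le_of_lt, fun hle => lt_of_le_of_ne hle fun e =>
        hs.2 (hoff T hTS hT3 s hs.1 e.symm)⟩
    have hpart : ∀ (T : Finset (EuclideanSpace ℝ (Fin 2))) (P : EuclideanSpace ℝ (Fin 2) → Prop),
        (∀ t ∈ T, ¬P t) →
        Set.ncard {s : EuclideanSpace ℝ (Fin 2) | s ∈ S ∧ P s} = #{s ∈ S \ T | P s} := by
      intro T P hP
      rw [← hside]
      congr 1
      ext s
      exact ⟨fun h => ⟨h.1, fun hT => hP s hT h.2, h.2⟩, fun h => ⟨h.1, h.2.2⟩⟩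
    have hset : {zr : EuclideanSpace ℝ (Fin 2) × ℝ | 0 < zr.2 ∧
        Set.ncard {s : EuclideanSpace ℝ (Fin 2) | s ∈ S ∧ dist s zr.1 = zr.2} = 3 ∧
        Set.ncard {s : EuclideanSpace ℝ (Fin 2) | s ∈ S ∧ dist s zr.1 < zr.2} = n - 1 ∧
        Set.ncard {s : EuclideanSpace ℝ (Fin 2) | s ∈ S ∧ zr.2 < dist s zr.1} = n - 1} =
        (fun T => (c T, r T)) '' (({T ∈ S.powersetCard 3 |
          #{s ∈ S \ T | dist s (c T) < r T} = n - 1} : Finset _) : Set _) := by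
      ext ⟨z, ρ⟩
      simp only [Set.mem_ofPred_eq, Set.mem_image, mem_coe, mem_filter, Prod.mk.injEq]
      constructor
      · rintro ⟨hρ, h3, hin, -⟩
        have hcoe : {s | s ∈ S ∧ dist s z = ρ} = (({s ∈ S | dist s z = ρ} : Finset _) : Set _) := by
          ext; simp
        rw [hcoe, Set.ncard_coe_finset] at h3
        have hTS : {s ∈ S | dist s z = ρ} ⊆ S := filter_subset _ _
        have honT : ∀ t ∈ {s ∈ S | dist s z = ρ}, dist t z = ρ := fun t ht => (mem_filter.1 ht).2
        obtain ⟨hz, hρ'⟩ := huniq _ hTS h3 z ρ honT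
        refine ⟨_, ⟨mem_powersetCard.2 ⟨hTS, h3⟩, ?_⟩, hz.symm, hρ'.symm⟩
        rw [← hz, ← hρ', ← hpart _ (fun s => dist s z < ρ) fun t ht => (honT t ht).not_lt]
        exact hin
      · rintro ⟨T, ⟨hT, hk⟩, rfl, rfl⟩
        have hT' := hsum T hT
        obtain ⟨hTS, hT3⟩ := mem_powersetCard.1 hT
        have honT := hon T hTS hT3
        refine ⟨hrpos T hTS hT3, ?_, ?_, ?_⟩
        · rw [← hT3, ← Set.ncard_coe_finset]
          congr 1
          ext s
          exact ⟨fun h => hoff T hTS hT3 s h.1 h.2, fun h => ⟨hTS h, honT s h⟩⟩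
        · rw [hpart T (fun s => dist s (c T) < r T) fun t ht => (honT t ht).not_lt, hk]
        · rw [hpart T (fun s => r T < dist s (c T)) fun t ht => (honT t ht).not_gt]
          omega
    rw [hset, Set.InjOn.ncard_image, Set.ncard_coe_finset]
    · have h := hcount (n - 1) (by omega)
      have heq : facetCount (fun T s => r T < dist s (c T)) S (n - 1) =
          facetCount (fun T s => dist s (c T) < r T) S (n - 1) := by
        unfold facetCount
        congr 1
        refine filter_congr fun T hT => ?_
        dsimp only
        have := hsum T hT
        omega
      rw [heq, hcard, show n - 1 + 1 = n by omega, show 2 * n + 1 - (n - 1) - 2 = n by omega] at h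
      unfold facetCount at h
      nlinarith
    · intro T hT T' hT' h
      obtain ⟨h1, h2⟩ := Prod.mk.inj h
      obtain ⟨hTS, hT3⟩ := mem_powersetCard.1 (mem_filter.1 (mem_coe.1 hT)).1
      obtain ⟨hTS', hT3'⟩ := mem_powersetCard.1 (mem_filter.1 (mem_coe.1 hT')).1
      refine eq_of_subset_of_card_le (fun t ht => hoff T' hTS' hT3' t (hTS ht) ?_) (by omega)
      rw [← h1, ← h2]
      exact hon T hTS hT3 t ht
end
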